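/- Let d > n+1 be a prime and let M_n be the n×n integer matrix with 2's on the diagonal and 1's off the diagonal (M_n = I_n + E_n, with E_n the all-ones matrix). Then the map U_{d,n}|x₁⟩…|x_n⟩ = |M_n x mod d⟩ on (ℂ^d)^{⊗n} is a unitary, and it is a maximally I₃-scrambling MIMO unitary with n inputs A₁,…,A_n and n outputs C₁,…,C_n each of dimension d: I₃(A_i; A_i^c; C_j) = −2 log₂ d for all i, j. -/

import Mathlib

open Matrix Filter
open scoped BigOperators Classical ComplexOrder

noncomputable section

universe u

namespace Scrambling

/-- A (possibly rectangular) matrix is unitary if `U Uᴴ = 1` and `Uᴴ U = 1`. -/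
def IsUnitaryMat {m n : Type*} [Fintype m] [Fintype n] [DecidableEq m] [DecidableEq n]
    (U : Matrix m n ℂ) : Prop :=
  U * Uᴴ = 1 ∧ Uᴴ * U = 1

/-- Base-2 von Neumann entropy of a (Hermitian) matrix. -/
def vNE {n : Type*} [Fintype n] [DecidableEq n] (ρ : Matrix n n ℂ) : ℝ :=
  if h : ρ.IsHermitian then (∑ i, Real.negMulLog (h.eigenvalues i)) / Real.log 2 else 0

instance sumElimFintype {I J : Type*} {FA : I → Type u} {FC : J → Type u}
    [∀ i, Fintype (FA i)] [∀ j, Fintype (FC j)] : ∀ k : I ⊕ J, Fintype (Sum.elim FA FC k)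
  | Sum.inl i => inferInstanceAs (Fintype (FA i))
  | Sum.inr j => inferInstanceAs (Fintype (FC j))

instance sumElimDecEq {I J : Type*} {FA : I → Type u} {FC : J → Type u}
    [∀ i, DecidableEq (FA i)] [∀ j, DecidableEq (FC j)] :
    ∀ k : I ⊕ J, DecidableEq (Sum.elim FA FC k)
  | Sum.inl i => inferInstanceAs (DecidableEq (FA i))
  | Sum.inr j => inferInstanceAs (DecidableEq (FC j))

section Marginals

variable {K : Type*} [Fintype K] [DecidableEq K] {F : K → Type*}
  [∀ k, Fintype (F k)] [∀ k, DecidableEq (F k)]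

/-- Marginal density matrix of the pure state `ψ` on the subsystems in `S`,
obtained by tracing out the subsystems in the complement of `S`. -/
def marg (S : Finset K) (ψ : (∀ k, F k) → ℂ) :
    Matrix (∀ k : {a // a ∈ S}, F k.val) (∀ k : {a // a ∈ S}, F k.val) ℂ :=
  Matrix.of fun x x' =>
    ∑ y : ∀ k : {a // a ∈ Sᶜ}, F k.val,
      ψ (fun k => if h : k ∈ S then x ⟨k, h⟩ else y ⟨k, Finset.mem_compl.mpr h⟩) *
      star (ψ (fun k => if h : k ∈ S then x' ⟨k, h⟩ else y ⟨k, Finset.mem_compl.mpr h⟩))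

/-- Entropy of the subsystems in `S` for the multipartite pure state `ψ`. -/
def Sm (S : Finset K) (ψ : (∀ k, F k) → ℂ) : ℝ := vNE (marg S ψ)

/-- Mutual information `I(X;Y)` between two disjoint collections of subsystems. -/
def Im (X Y : Finset K) (ψ : (∀ k, F k) → ℂ) : ℝ :=
  Sm X ψ + Sm Y ψ - Sm (X ∪ Y) ψ

/-- Tripartite information `I₃(X;Y;Z) = I(X;Y) + I(X;Z) - I(X;YZ)`. -/
def I3m (X Y Z : Finset K) (ψ : (∀ k, F k) → ℂ) : ℝ :=
  Im X Y ψ + Im X Z ψ - Im X (Y ∪ Z) ψ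

end Marginals

/-- The Choi state vector of a MIMO unitary `U : A₁ ⊗ ⋯ ⊗ A_n → C₁ ⊗ ⋯ ⊗ C_m`,
obtained by feeding one half of a maximally entangled state into each input. -/
def mChoi {I J : Type*} [Fintype I] [Fintype J] {FA : I → Type u} {FC : J → Type u}
    [∀ i, Fintype (FA i)]
    (U : Matrix (∀ j, FC j) (∀ i, FA i) ℂ) :
    (∀ k : I ⊕ J, Sum.elim FA FC k) → ℂ :=
  fun h => (Real.sqrt (Fintype.card (∀ i, FA i)) : ℂ)⁻¹ *
    U (fun j => h (Sum.inr j)) (fun i => h (Sum.inl i))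

/-- A MIMO unitary is minimally I₃-scrambling if `I₃(A_i; A_i^c; C_j) = 0`
for all inputs `A_i` and outputs `C_j`. -/
def MinScrambling {I J : Type*} [Fintype I] [Fintype J] [DecidableEq I] [DecidableEq J]
    {FA : I → Type u} {FC : J → Type u}
    [∀ i, Fintype (FA i)] [∀ j, Fintype (FC j)]
    [∀ i, DecidableEq (FA i)] [∀ j, DecidableEq (FC j)]
    (U : Matrix (∀ j, FC j) (∀ i, FA i) ℂ) : Prop :=
  ∀ (i : I) (j : J),
    I3m ({Sum.inl i} : Finset (I ⊕ J)) ((Finset.univ.erase i).image Sum.inl)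
      ({Sum.inr j} : Finset (I ⊕ J)) (mChoi U) = 0


/-- The MIMO unitary `|x⟩ ↦ |M_n x mod d⟩` where `M_n = I_n + E_n` has 2's on the diagonal
and 1's off the diagonal, so `(M_n x)_i = x_i + ∑ₖ x_k`. -/
def arithU (n d : ℕ) [NeZero d] : Matrix (Fin n → ZMod d) (Fin n → ZMod d) ℂ :=
  Matrix.of fun y x => if y = (fun i => x i + ∑ k, x k) then 1 else 0

lemma vNE_of_sq {X : Type*} [Fintype X] [DecidableEq X] (ρ : Matrix X X ℂ) (c : ℝ)
    (h : ρ.IsHermitian) (hsq : ρ * ρ = (c : ℂ) • ρ) (htr : ρ.trace = 1) :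
    vNE ρ = - Real.logb 2 c := by
  have hev : ∀ i, h.eigenvalues i * h.eigenvalues i = c * h.eigenvalues i := by
    intro i
    have h1 := h.mulVec_eigenvectorBasis i
    set v : X → ℂ := ⇑(h.eigenvectorBasis i) with hv
    have hv0 : v ≠ 0 := by
      intro h0
      have := (h.eigenvectorBasis).orthonormal.ne_zero i
      apply this
      ext k
      exact congrFun h0 k
    have h2 : (ρ * ρ) *ᵥ v = (h.eigenvalues i * h.eigenvalues i) • v := by
      rw [← Matrix.mulVec_mulVec, h1, Matrix.mulVec_smul, h1, smul_smul]
    have h3 : (ρ * ρ) *ᵥ v = (c * h.eigenvalues i) • v := by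
      rw [hsq, Matrix.smul_mulVec, h1, mul_smul]
      rfl
    have h4 := h2.symm.trans h3
    exact smul_left_injective ℝ hv0 h4
  have hsum : ∑ i, h.eigenvalues i = 1 := by
    have := h.trace_eq_sum_eigenvalues
    rw [htr] at this
    have h5 : ((∑ i, h.eigenvalues i : ℝ) : ℂ) = 1 := by
      rw [this]; push_cast; rfl
    exact_mod_cast h5
  have hn : ∀ i, Real.negMulLog (h.eigenvalues i) = h.eigenvalues i * (- Real.log c) := by
    intro i
    by_cases h0 : h.eigenvalues i = 0
    · simp [h0]
    · have := mul_right_cancel₀ h0 (hev i)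
      rw [Real.negMulLog, this]; ring
  rw [vNE, dif_pos h, Finset.sum_congr rfl (fun i _ => hn i), ← Finset.sum_mul, hsum, Real.logb]
  ring

lemma vNE_left {X Y : Type*} [Fintype X] [DecidableEq X] [Fintype Y] [DecidableEq Y]
    (V : Matrix X Y ℂ) (c : ℂ) (h1 : (V * Vᴴ).trace = 1) (h : V * Vᴴ = c • 1) :
    vNE (V * Vᴴ) = Real.logb 2 (Fintype.card X) := by
  have hc : c * Fintype.card X = 1 := by
    rw [h] at h1
    simpa [Matrix.trace_smul, Matrix.trace_one] using h1
  have hX : (Fintype.card X : ℂ) ≠ 0 := by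
    intro h0; simp [h0] at hc
  have hc' : c = (((Fintype.card X : ℝ)⁻¹ : ℝ) : ℂ) := by
    push_cast; exact eq_inv_of_mul_eq_one_left hc
  rw [vNE_of_sq (V * Vᴴ) ((Fintype.card X : ℝ)⁻¹) (Matrix.isHermitian_mul_conjTranspose_self V) ?_ h1]
  · rw [Real.logb_inv, neg_neg]
  · rw [← hc']
    nth_rewrite 1 [h]
    simp

lemma vNE_right {X Y : Type*} [Fintype X] [DecidableEq X] [Fintype Y] [DecidableEq Y]
    (V : Matrix X Y ℂ) (c : ℂ) (h1 : (V * Vᴴ).trace = 1) (h : Vᴴ * V = c • 1) :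
    vNE (V * Vᴴ) = Real.logb 2 (Fintype.card Y) := by
  have hc : c * Fintype.card Y = 1 := by
    rw [Matrix.trace_mul_comm, h] at h1
    simpa [Matrix.trace_smul, Matrix.trace_one] using h1
  have hX : (Fintype.card Y : ℂ) ≠ 0 := by
    intro h0; simp [h0] at hc
  have hc' : c = (((Fintype.card Y : ℝ)⁻¹ : ℝ) : ℂ) := by
    push_cast; exact eq_inv_of_mul_eq_one_left hc
  rw [vNE_of_sq (V * Vᴴ) ((Fintype.card Y : ℝ)⁻¹) (Matrix.isHermitian_mul_conjTranspose_self V) ?_ h1]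
  · rw [Real.logb_inv, neg_neg]
  · rw [← hc', Matrix.mul_assoc, ← Matrix.mul_assoc Vᴴ, h]
    simp

lemma count_lemma {X Y : Type*} [Fintype X] [DecidableEq X] [Fintype Y] [DecidableEq Y]
    [AddCommGroup X] [AddCommGroup Y] (g : X → Y → Prop) (a : ℂ)
    (hadd : ∀ x y x' y', g x y → g x' y' → g (x + x') (y + y'))
    (hsub : ∀ x y x' y', g x y → g x' y' → g (x - x') (y - y'))
    (hinj : ∀ x, g x 0 → x = 0) (hsurj : ∀ x, ∃ y, g x y) (x x' : X) :
    ∑ y, (a * if g x y then 1 else 0) * star (a * if g x' y then 1 else 0)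
      = (∑ y, (a * if g 0 y then 1 else 0) * star (a * if g 0 y then 1 else 0)) *
        (if x = x' then 1 else 0) := by
  by_cases hx : x = x'
  · subst hx
    obtain ⟨y0, hy0⟩ := hsurj x
    rw [if_pos rfl, mul_one, ← Equiv.sum_comp (Equiv.addRight y0)]
    refine Finset.sum_congr rfl fun y _ => ?_
    have : g x (y + y0) ↔ g 0 y := by
      constructor
      · intro h
        simpa using hsub _ _ _ _ h hy0
      · intro h
        simpa using hadd _ _ _ _ h hy0
    simp only [Equiv.coe_addRight, this]
  · rw [if_neg hx, mul_zero]
    refine Finset.sum_eq_zero fun y _ => ?_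
    by_cases h : g x y
    · have : ¬ g x' y := by
        intro h'
        have := hsub _ _ _ _ h h'
        rw [sub_self] at this
        exact hx (sub_eq_zero.mp (hinj _ this))
      simp [this]
    · simp [h]

section Gen

set_option linter.unusedSectionVars false

variable {K : Type*} [Fintype K] [DecidableEq K] {F : K → Type*}
  [∀ k, Fintype (F k)] [∀ k, DecidableEq (F k)]

def mrg (S : Finset K) (x : ∀ k : {a // a ∈ S}, F k.val) (y : ∀ k : {a // a ∈ Sᶜ}, F k.val) :
    ∀ k, F k :=
  fun k => if h : k ∈ S then x ⟨k, h⟩ else y ⟨k, Finset.mem_compl.mpr h⟩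

def mrgEquiv (S : Finset K) :
    ((∀ k : {a // a ∈ S}, F k.val) × (∀ k : {a // a ∈ Sᶜ}, F k.val)) ≃ (∀ k, F k) where
  toFun p := mrg S p.1 p.2
  invFun h := (fun k => h k.1, fun k => h k.1)
  left_inv p := by
    ext k
    · simp [mrg, k.2]
    · have := Finset.mem_compl.mp k.2
      simp [mrg, this]
  right_inv h := by
    ext k
    simp [mrg]

def Vm (S : Finset K) (ψ : (∀ k, F k) → ℂ) :
    Matrix (∀ k : {a // a ∈ S}, F k.val) (∀ k : {a // a ∈ Sᶜ}, F k.val) ℂ :=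
  Matrix.of fun x y => ψ (mrg S x y)

lemma marg_eq (S : Finset K) (ψ : (∀ k, F k) → ℂ) : marg S ψ = Vm S ψ * (Vm S ψ)ᴴ := by
  ext x x'
  rfl

lemma trace_Vm (S : Finset K) (ψ : (∀ k, F k) → ℂ) (h1 : ∑ h, ψ h * star (ψ h) = 1) :
    (Vm S ψ * (Vm S ψ)ᴴ).trace = 1 := by
  rw [← h1, ← Equiv.sum_comp (mrgEquiv S), Fintype.sum_prod_type]
  rfl

variable [∀ k, AddCommGroup (F k)]

lemma mrg_add (S : Finset K) (x x' : ∀ k : {a // a ∈ S}, F k.val)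
    (y y' : ∀ k : {a // a ∈ Sᶜ}, F k.val) :
    mrg S (x + x') (y + y') = mrg S x y + mrg S x' y' := by
  ext k
  by_cases h : k ∈ S <;> simp [mrg, h]

lemma mrg_sub (S : Finset K) (x x' : ∀ k : {a // a ∈ S}, F k.val)
    (y y' : ∀ k : {a // a ∈ Sᶜ}, F k.val) :
    mrg S (x - x') (y - y') = mrg S x y - mrg S x' y' := by
  ext k
  by_cases h : k ∈ S <;> simp [mrg, h]

lemma Sm_left (G : AddSubgroup (∀ k, F k)) (a : ℂ) (ψ : (∀ k, F k) → ℂ)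
    (hψ : ∀ h, ψ h = a * if h ∈ G then 1 else 0)
    (h1 : ∑ h, ψ h * star (ψ h) = 1) (S T : Finset K) (hST : S ⊆ T)
    (hinj : ∀ h ∈ G, (∀ k, k ∉ T → h k = 0) → h = 0)
    (hsurj : ∀ x : ∀ k, F k, ∃ h ∈ G, ∀ k ∈ T, h k = x k) :
    Sm S ψ = Real.logb 2 (∏ k ∈ S, (Fintype.card (F k) : ℝ)) := by
  have key := count_lemma (fun x y => mrg S x y ∈ G) a
    (fun x y x' y' h h' => by rw [mrg_add]; exact G.add_mem h h')
    (fun x y x' y' h h' => by rw [mrg_sub]; exact G.sub_mem h h')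
    (fun x hx => by
      have h0 := hinj _ hx (fun k hk => by
        have : k ∉ S := fun h => hk (hST h)
        simp [mrg, this])
      ext k
      have := congrFun h0 k.1
      simpa [mrg, k.2] using this)
    (fun x => by
      obtain ⟨h, hG, hh⟩ := hsurj (mrg S x 0)
      refine ⟨fun k => h k.1, ?_⟩
      convert hG using 1
      ext k
      by_cases hk : k ∈ S
      · have := hh k (hST hk)
        rw [this]; simp [mrg, hk]
      · simp [mrg, hk])
  rw [Sm, marg_eq, vNE_left _ (∑ y, (a * if mrg S 0 y ∈ G then 1 else 0) * star (a * if mrg S 0 y ∈ G then 1 else 0))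
    (trace_Vm S ψ h1) ?_]
  · rw [Fintype.card_pi, Finset.prod_coe_sort S (fun k => Fintype.card (F k))]
    push_cast; rfl
  · ext x x'
    rw [Matrix.smul_apply, Matrix.one_apply, smul_eq_mul, ← key x x', Matrix.mul_apply]
    refine Finset.sum_congr rfl fun y _ => ?_
    simp only [Vm, Matrix.of_apply, Matrix.conjTranspose_apply, hψ]

lemma Sm_right (G : AddSubgroup (∀ k, F k)) (a : ℂ) (ψ : (∀ k, F k) → ℂ)
    (hψ : ∀ h, ψ h = a * if h ∈ G then 1 else 0)
    (h1 : ∑ h, ψ h * star (ψ h) = 1) (S : Finset K)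
    (hinj : ∀ h ∈ G, (∀ k, k ∈ S → h k = 0) → h = 0)
    (hsurj : ∀ x : ∀ k, F k, ∃ h ∈ G, ∀ k ∉ S, h k = x k) :
    Sm S ψ = Real.logb 2 (∏ k ∈ Sᶜ, (Fintype.card (F k) : ℝ)) := by
  have key := count_lemma (fun y x => mrg S x y ∈ G) a
    (fun x y x' y' h h' => by rw [mrg_add]; exact G.add_mem h h')
    (fun x y x' y' h h' => by rw [mrg_sub]; exact G.sub_mem h h')
    (fun x hx => by
      have h0 := hinj _ hx (fun k hk => by
        simp [mrg, hk])
      ext k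
      have := congrFun h0 k.1
      have hk := Finset.mem_compl.mp k.2
      simpa [mrg, hk] using this)
    (fun x => by
      obtain ⟨h, hG, hh⟩ := hsurj (mrg S 0 x)
      refine ⟨fun k => h k.1, ?_⟩
      convert hG using 1
      ext k
      by_cases hk : k ∈ S
      · simp [mrg, hk]
      · have := hh k hk
        rw [this]; simp [mrg, hk])
  rw [Sm, marg_eq, vNE_right _ (∑ x, (a * if mrg S x 0 ∈ G then 1 else 0) * star (a * if mrg S x 0 ∈ G then 1 else 0))
    (trace_Vm S ψ h1) ?_]
  · rw [Fintype.card_pi, Finset.prod_coe_sort Sᶜ (fun k => Fintype.card (F k))]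
    push_cast; rfl
  · ext y y'
    rw [Matrix.smul_apply, Matrix.one_apply, smul_eq_mul,
      show (if y = y' then (1 : ℂ) else 0) = if y' = y then 1 else 0 by simp only [eq_comm],
      ← key y' y, Matrix.mul_apply]
    refine Finset.sum_congr rfl fun x _ => ?_
    simp only [Vm, Matrix.of_apply, Matrix.conjTranspose_apply, hψ]
    rw [mul_comm]

end Gen

section Arith

variable {n d : ℕ}

def Mx (x : Fin n → ZMod d) : Fin n → ZMod d := fun i => x i + ∑ k, x k

lemma Mx_sub (x y : Fin n → ZMod d) : Mx (x - y) = Mx x - Mx y := by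
  ext i; simp [Mx, Finset.sum_sub_distrib]; ring

lemma Mx_add (x y : Fin n → ZMod d) : Mx (x + y) = Mx x + Mx y := by
  ext i; simp [Mx, Finset.sum_add_distrib]; ring

lemma Mx_zero : Mx (0 : Fin n → ZMod d) = 0 := by
  ext i; simp [Mx]

lemma cast_ne (hd : n + 1 < d) (m : ℕ) (hm : m ≤ n + 1) (h0 : 0 < m) : (m : ZMod d) ≠ 0 := by
  intro h
  rw [ZMod.natCast_eq_zero_iff] at h
  have := Nat.le_of_dvd h0 h
  omega

lemma Mx_ker (hp : d.Prime) (hd : n + 1 < d) (x : Fin n → ZMod d) (h : Mx x = 0) : x = 0 := by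
  have := Fact.mk hp
  have hx : ∀ k, x k = - ∑ k, x k := fun k => eq_neg_of_add_eq_zero_left (congrFun h k)
  have hs : ((n + 1 : ℕ) : ZMod d) * ∑ k, x k = 0 := by
    have : ∑ k, x k = ∑ k : Fin n, (- ∑ k, x k) := Finset.sum_congr rfl fun k _ => hx k
    simp only [Finset.sum_const, Finset.card_univ, Fintype.card_fin, nsmul_eq_mul] at this
    push_cast
    linear_combination this
  have h0 := (mul_eq_zero.mp hs).resolve_left (cast_ne hd _ le_rfl (Nat.succ_pos _))
  ext k
  rw [hx k, h0]; simp

lemma Mx_inj (hp : d.Prime) (hd : n + 1 < d) : Function.Injective (Mx : (Fin n → ZMod d) → _) := by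
  intro x y h
  have := Mx_ker hp hd (x - y) (by rw [Mx_sub, h, sub_self])
  exact sub_eq_zero.mp this

lemma Mx_bij [NeZero d] (hp : d.Prime) (hd : n + 1 < d) :
    Function.Bijective (Mx : (Fin n → ZMod d) → _) :=
  Finite.injective_iff_bijective.mp (Mx_inj hp hd)

lemma two_ne (hd : n + 1 < d) (hn : 2 ≤ n) : (2 : ZMod d) ≠ 0 := by
  have := cast_ne hd 2 (by omega) (by omega)
  exact_mod_cast this

lemma ker_YZ (hp : d.Prime) (hd : n + 1 < d) (hn : 2 ≤ n) (i j : Fin n) (x : Fin n → ZMod d)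
    (hi : x i = 0) (hj : ∀ k, k ≠ j → Mx x k = 0) : x = 0 := by
  have := Fact.mk hp
  have hx : ∀ k, k ≠ j → x k = - ∑ k, x k := fun k hk => eq_neg_of_add_eq_zero_left (hj k hk)
  have hs : ∑ k, x k = x j + ∑ k ∈ Finset.univ.erase j, x k :=
    (Finset.add_sum_erase _ _ (Finset.mem_univ j)).symm
  have hs2 : ∑ k ∈ Finset.univ.erase j, x k = ((n - 1 : ℕ) : ZMod d) * (- ∑ k, x k) := by
    rw [Finset.sum_congr rfl (fun k hk => hx k (Finset.ne_of_mem_erase hk))]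
    simp
  have hs0 : ∑ k, x k = 0 := by
    by_cases hij : i = j
    · subst hij
      rw [hs2, hi] at hs
      have : ((n : ℕ) : ZMod d) * ∑ k, x k = 0 := by
        rw [Nat.cast_sub (by omega)] at hs
        push_cast at hs
        linear_combination hs
      exact (mul_eq_zero.mp this).resolve_left (cast_ne hd _ (by omega) (by omega))
    · have := hx i hij
      rw [hi] at this
      exact neg_eq_zero.mp this.symm
  ext k
  by_cases hk : k = j
  · subst hk
    rw [hs2, hs0] at hs
    simpa using hs.symm
  · rw [hx k hk, hs0]; simp

lemma ker_XZ (hp : d.Prime) (hd : n + 1 < d) (hn : 2 ≤ n) (i j : Fin n) (x : Fin n → ZMod d)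
    (hi : ∀ k, k ≠ i → x k = 0) (hj : ∀ k, k ≠ j → Mx x k = 0) : x = 0 := by
  have := Fact.mk hp
  have : Nontrivial (Fin n) := Fin.nontrivial_iff_two_le.mpr hn
  have hs : ∑ k, x k = x i := Finset.sum_eq_single i (fun k _ hk => hi k hk) (by simp)
  obtain ⟨k, hk⟩ := exists_ne j
  have h1 : x k + x i = 0 := by rw [← hs]; exact hj k hk
  have h2 : x i = 0 := by
    by_cases hki : k = i
    · subst hki
      have : 2 * x k = 0 := by linear_combination h1
      exact (mul_eq_zero.mp this).resolve_left (two_ne hd hn)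
    · rw [hi k hki] at h1; simpa using h1
  ext l
  by_cases hl : l = i
  · rw [hl, h2]; rfl
  · exact hi l hl

lemma ext_YZ (hp : d.Prime) (hd : n + 1 < d) (hn : 2 ≤ n) (i j : Fin n) (x : Fin n → ZMod d)
    (z : ZMod d) : ∃ x' : Fin n → ZMod d, (∀ k, k ≠ i → x' k = x k) ∧ Mx x' j = z := by
  have := Fact.mk hp
  have hc : Mx (Pi.single i (1 : ZMod d)) j ≠ 0 := by
    by_cases h : j = i
    · subst h
      simp only [Mx, Pi.single_eq_same, Finset.sum_pi_single', Finset.mem_univ, if_true]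
      have := two_ne (n := n) hd hn
      simpa [one_add_one_eq_two] using this
    · simp [Mx, h, Finset.sum_pi_single]
  have hsm : ∀ t : ZMod d, Mx (t • (Pi.single i (1 : ZMod d) : Fin n → ZMod d)) j
      = t * Mx (Pi.single i (1 : ZMod d)) j := by
    intro t
    simp only [Mx, Pi.smul_apply, smul_eq_mul, ← Finset.mul_sum]
    ring
  refine ⟨x + ((z - Mx x j) / Mx (Pi.single i (1 : ZMod d)) j) • Pi.single i (1 : ZMod d), ?_, ?_⟩
  · intro k hk
    simp [hk]
  · rw [Mx_add, Pi.add_apply, hsm]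
    field_simp
    ring

lemma ext_XZ (hp : d.Prime) (hd : n + 1 < d) (hn : 2 ≤ n) (i j : Fin n)
    (a z : ZMod d) : ∃ x' : Fin n → ZMod d, x' i = a ∧ Mx x' j = z := by
  have : Nontrivial (Fin n) := Fin.nontrivial_iff_two_le.mpr hn
  obtain ⟨l, hl⟩ := exists_ne i
  obtain ⟨x', h1, h2⟩ := ext_YZ hp hd hn l j (fun _ => a) z
  exact ⟨x', h1 i hl.symm, h2⟩

instance sumElimGrp (n d : ℕ) :
    ∀ k : Fin n ⊕ Fin n, AddCommGroup (Sum.elim (fun _ : Fin n => ZMod d) (fun _ : Fin n => ZMod d) k)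
  | Sum.inl _ => inferInstanceAs (AddCommGroup (ZMod d))
  | Sum.inr _ => inferInstanceAs (AddCommGroup (ZMod d))

abbrev FF (n d : ℕ) : Fin n ⊕ Fin n → Type :=
  Sum.elim (fun _ : Fin n => ZMod d) (fun _ : Fin n => ZMod d)

def lft (h : ∀ k, FF n d k) : Fin n → ZMod d := fun k => h (Sum.inl k)
def rgt (h : ∀ k, FF n d k) : Fin n → ZMod d := fun k => h (Sum.inr k)
def mk2 (x y : Fin n → ZMod d) : ∀ k, FF n d k
  | Sum.inl k => x k
  | Sum.inr k => y k

def GG (n d : ℕ) : AddSubgroup (∀ k, FF n d k) where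
  carrier := {h | rgt h = Mx (lft h)}
  zero_mem' := by
    show (0 : Fin n → ZMod d) = Mx (0 : Fin n → ZMod d)
    rw [Mx_zero]
  add_mem' := by
    intro a b ha hb
    show rgt a + rgt b = Mx (lft a + lft b)
    rw [Mx_add, ← (show rgt a = Mx (lft a) from ha), ← (show rgt b = Mx (lft b) from hb)]
  neg_mem' := by
    intro a ha
    show - rgt a = Mx (- lft a)
    have := Mx_sub 0 (lft a)
    rw [Mx_zero, zero_sub, zero_sub] at this
    rw [this, ← (show rgt a = Mx (lft a) from ha)]

lemma mem_GG (h : ∀ k, FF n d k) : h ∈ GG n d ↔ rgt h = Mx (lft h) := Iff.rfl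

lemma mk2_mem (x : Fin n → ZMod d) : mk2 x (Mx x) ∈ GG n d := rfl

lemma eq_zero_of (h : ∀ k, FF n d k) (hG : h ∈ GG n d) (h0 : lft h = 0) : h = 0 := by
  have h1 : rgt h = 0 := by rw [(mem_GG h).mp hG, h0, Mx_zero]
  funext k
  rcases k with k | k
  · exact congrFun h0 k
  · exact congrFun h1 k

lemma card_FF [NeZero d] (k : Fin n ⊕ Fin n) : Fintype.card (FF n d k) = d := by
  rcases k with k | k
  · exact ZMod.card d
  · exact ZMod.card d

lemma psi_eq [NeZero d] (h : ∀ k, FF n d k) :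
    mChoi (FA := fun _ : Fin n => ZMod d) (FC := fun _ : Fin n => ZMod d) (arithU n d) h
      = (Real.sqrt (Fintype.card (Fin n → ZMod d)) : ℂ)⁻¹ * if h ∈ GG n d then 1 else 0 := by
  have e : arithU n d (rgt h) (lft h) = if h ∈ GG n d then 1 else 0 := by
    rw [arithU, Matrix.of_apply]
    exact if_congr Iff.rfl rfl rfl
  rw [← e, mChoi]
  refine congrArg₂ _ ?_ rfl
  congr!

def splitEquiv (n d : ℕ) : (∀ k, FF n d k) ≃ (Fin n → ZMod d) × (Fin n → ZMod d) where
  toFun h := (lft h, rgt h)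
  invFun p := mk2 p.1 p.2
  left_inv h := by
    funext k
    rcases k with k | k <;> rfl
  right_inv p := rfl

lemma psi_norm [NeZero d] : ∑ h, mChoi (FA := fun _ : Fin n => ZMod d)
    (FC := fun _ : Fin n => ZMod d) (arithU n d) h *
    star (mChoi (FA := fun _ : Fin n => ZMod d) (FC := fun _ : Fin n => ZMod d) (arithU n d) h)
      = 1 := by
  rw [← Equiv.sum_comp (splitEquiv n d).symm, Fintype.sum_prod_type]
  have hN : (0 : ℝ) < Fintype.card (Fin n → ZMod d) := by exact_mod_cast Fintype.card_pos
  have : ∀ x y : Fin n → ZMod d, mChoi (FA := fun _ : Fin n => ZMod d)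
      (FC := fun _ : Fin n => ZMod d) (arithU n d) ((splitEquiv n d).symm (x, y)) *
      star (mChoi (FA := fun _ : Fin n => ZMod d) (FC := fun _ : Fin n => ZMod d) (arithU n d)
        ((splitEquiv n d).symm (x, y)))
      = if y = Mx x then (Fintype.card (Fin n → ZMod d) : ℂ)⁻¹ else 0 := by
    intro x y
    rw [psi_eq]
    have hm : ((splitEquiv n d).symm (x, y) ∈ GG n d) = (y = Mx x) := rfl
    simp only [hm]
    by_cases h : y = Mx x
    · simp only [if_pos h, mul_one]
      rw [← Complex.ofReal_inv, Complex.star_def, Complex.conj_ofReal, ← Complex.ofReal_mul,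
        ← mul_inv, Real.mul_self_sqrt hN.le]
      push_cast; rfl
    · simp [h]
  simp only [this]
  simp only [Finset.sum_ite_eq', Finset.mem_univ, if_true, Finset.sum_const, Finset.card_univ,
    nsmul_eq_mul]
  refine mul_inv_cancel₀ ?_
  exact_mod_cast hN.ne'

lemma arith_unitary [NeZero d] (hp : d.Prime) (hd : n + 1 < d) : IsUnitaryMat (arithU n d) := by
  have h2 : (arithU n d)ᴴ * arithU n d = 1 := by
    ext x x'
    have e : ∀ y x, arithU n d y x = if y = Mx x then 1 else 0 := fun _ _ => rfl
    rw [Matrix.mul_apply]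
    simp only [Matrix.conjTranspose_apply, e, Matrix.one_apply]
    simp [(Mx_inj hp hd).eq_iff, eq_comm]
  exact ⟨mul_eq_one_comm.mp h2, h2⟩

end Arith

/-- For a prime `d > n + 1` (and `n ≥ 2`), the map `|x⟩ ↦ |M_n x mod d⟩`
with `M_n = I_n + E_n` is a unitary on `(ℂ^d)^{⊗n}`, and it is a maximally I₃-scrambling
MIMO unitary: `I₃(A_i; A_i^c; C_j) = -2 log₂ d` for all `i, j`. -/
theorem arithU_maximally_scrambling (n d : ℕ) [NeZero d] (hp : d.Prime)
    (hd : n + 1 < d) (hn : 2 ≤ n) :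
    IsUnitaryMat (arithU n d) ∧
    ∀ i j : Fin n,
      I3m ({Sum.inl i} : Finset (Fin n ⊕ Fin n))
        ((Finset.univ.erase i).image Sum.inl)
        ({Sum.inr j} : Finset (Fin n ⊕ Fin n))
        (mChoi (FA := fun _ : Fin n => ZMod d) (FC := fun _ : Fin n => ZMod d)
          (arithU n d)) = -2 * Real.logb 2 d := by
  refine ⟨arith_unitary hp hd, fun i j => ?_⟩
  set ψ := mChoi (FA := fun _ : Fin n => ZMod d) (FC := fun _ : Fin n => ZMod d) (arithU n d)
    with hψ
  have h1 : ∑ h, ψ h * star (ψ h) = 1 := psi_norm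
  set X : Finset (Fin n ⊕ Fin n) := {Sum.inl i} with hX
  set Y : Finset (Fin n ⊕ Fin n) := (Finset.univ.erase i).image Sum.inl with hY
  set Z : Finset (Fin n ⊕ Fin n) := {Sum.inr j} with hZ
  have mX : ∀ k, k ∈ X ↔ k = Sum.inl i := by simp [hX]
  have mZ : ∀ k, k ∈ Z ↔ k = Sum.inr j := by simp [hZ]
  have mYl : ∀ k, Sum.inl k ∈ Y ↔ k ≠ i := by simp [hY]
  have mYr : ∀ k, Sum.inr k ∉ Y := by simp [hY]
  have cX : X.card = 1 := by simp [hX]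
  have cZ : Z.card = 1 := by simp [hZ]
  have cY : Y.card = n - 1 := by
    rw [hY, Finset.card_image_of_injective _ Sum.inl_injective]; simp
  have cXY : (X ∪ Y).card = n := by
    rw [Finset.card_union_of_disjoint, cX, cY]
    · omega
    · simp [hX, hY]
  have cXZ : (X ∪ Z).card = 2 := by
    rw [Finset.card_union_of_disjoint, cX, cZ]
    simp [hX, hZ]
  have cYZ : (Y ∪ Z).card = n := by
    rw [Finset.card_union_of_disjoint, cY, cZ]
    · omega
    · simp [hZ, hY]
  have cXYZ : ((X ∪ (Y ∪ Z))ᶜ).card = n - 1 := by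
    rw [Finset.card_compl, Finset.card_union_of_disjoint, cX, cYZ]
    · simp; omega
    · simp [hX, hY, hZ]
  have logs : ∀ S : Finset (Fin n ⊕ Fin n),
      Real.logb 2 (∏ k ∈ S, (Fintype.card (FF n d k) : ℝ)) = S.card * Real.logb 2 d := by
    intro S
    rw [Finset.prod_congr rfl (fun k _ => by rw [card_FF k]), Finset.prod_const, Real.logb_pow]
  have LXY : ∀ S, S ⊆ X ∪ Y → Sm S ψ = S.card * Real.logb 2 d := by
    intro S hS
    rw [← logs]
    refine Sm_left (GG n d) _ ψ psi_eq h1 S (X ∪ Y) hS ?_ ?_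
    · intro h hG hk
      refine eq_zero_of h hG (Mx_ker hp hd _ ?_)
      rw [← (mem_GG h).mp hG]
      funext k
      exact hk (Sum.inr k) (by simp [mX, mYr])
    · intro x
      refine ⟨mk2 (lft x) (Mx (lft x)), mk2_mem _, ?_⟩
      rintro (k | k) hk
      · rfl
      · simp [mX, mYr] at hk
  have LYZ : ∀ S, S ⊆ Y ∪ Z → Sm S ψ = S.card * Real.logb 2 d := by
    intro S hS
    rw [← logs]
    refine Sm_left (GG n d) _ ψ psi_eq h1 S (Y ∪ Z) hS ?_ ?_
    · intro h hG hk
      refine eq_zero_of h hG (ker_YZ hp hd hn i j _ ?_ ?_)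
      · exact hk (Sum.inl i) (by simp [mZ, mYl])
      · intro k hkj
        rw [← (mem_GG h).mp hG]
        exact hk (Sum.inr k) (by simp [mZ, mYr, hkj])
    · intro x
      obtain ⟨x', e1, e2⟩ := ext_YZ hp hd hn i j (lft x) (rgt x j)
      refine ⟨mk2 x' (Mx x'), mk2_mem _, ?_⟩
      rintro (k | k) hk
      · exact e1 k (by simpa [mZ, mYl] using hk)
      · have : k = j := by simpa [mZ, mYr] using hk
        subst this
        exact e2
  have LXZ : ∀ S, S ⊆ X ∪ Z → Sm S ψ = S.card * Real.logb 2 d := by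
    intro S hS
    rw [← logs]
    refine Sm_left (GG n d) _ ψ psi_eq h1 S (X ∪ Z) hS ?_ ?_
    · intro h hG hk
      refine eq_zero_of h hG (ker_XZ hp hd hn i j _ ?_ ?_)
      · intro k hki
        exact hk (Sum.inl k) (by simp [mZ, mX, hki])
      · intro k hkj
        rw [← (mem_GG h).mp hG]
        exact hk (Sum.inr k) (by simp [mZ, mX, hkj])
    · intro x
      obtain ⟨x', e1, e2⟩ := ext_XZ hp hd hn i j (lft x i) (rgt x j)
      refine ⟨mk2 x' (Mx x'), mk2_mem _, ?_⟩
      rintro (k | k) hk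
      · have : k = i := by simpa [mZ, mX] using hk
        subst this
        exact e1
      · have : k = j := by simpa [mZ, mX] using hk
        subst this
        exact e2
  have LXYZ : Sm (X ∪ (Y ∪ Z)) ψ = ((X ∪ (Y ∪ Z))ᶜ).card * Real.logb 2 d := by
    rw [← logs]
    refine Sm_right (GG n d) _ ψ psi_eq h1 _ ?_ ?_
    · intro h hG hk
      refine eq_zero_of h hG ?_
      funext k
      exact hk (Sum.inl k) (by simp [mX, mYl, mZ, em])
    · intro x
      obtain ⟨x', e⟩ := (Mx_bij hp hd).2 (rgt x)
      refine ⟨mk2 x' (Mx x'), mk2_mem _, ?_⟩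
      rintro (k | k) hk
      · exact absurd (by simp [mX, mYl, mZ, em]) hk
      · exact congrFun e k
  rw [I3m, Im, Im, Im, LXYZ, LXY X Finset.subset_union_left, LXY Y Finset.subset_union_right,
    LXY _ subset_rfl, LYZ Z Finset.subset_union_right, LYZ _ subset_rfl, LXZ _ subset_rfl,
    cX, cY, cZ, cXY, cXZ, cYZ, cXYZ]
  push_cast [Nat.cast_sub (show 1 ≤ n by omega)]
  ring

end Scrambling

end
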